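/- arXiv:2603.28352 — 2 statements merged into one kernel-verified Lean document; each statement's English description precedes it below -/
import Mathlib

section
/- A point θ₀ ∈ [0, π] satisfies f(θ₀) = 0 if and only if t₀ = u·cos θ₀ is a root of P; moreover the map θ ↦ u·cos θ restricts to a bijection from the set {θ ∈ [0, π] : f(θ) = 0} onto the set {t ∈ [−u, u] : P(t) = 0}. (Corollary 2 of the paper.) -/
theorem Real.cos_five_mul (x : ℝ) :
    Real.cos (5 * x) = 16 * Real.cos x ^ 5 - 20 * Real.cos x ^ 3 + 5 * Real.cos x := by
  rw [show 5 * x = 2 * x + 3 * x by ring, Real.cos_add, Real.cos_two_mul, Real.cos_three_mul,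
    Real.sin_two_mul, Real.sin_three_mul]
  linear_combination 2 * Real.cos x * (4 * Real.sin x ^ 2 - 4 * Real.cos x ^ 2 + 1) *
    Real.sin_sq_add_cos_sq x

/-- Corollary 2: θ₀ ∈ [0, π] is a zero of f iff u·cos θ₀ is a root of P, and
θ ↦ u·cos θ is a bijection from the zeros of f in [0, π] onto the roots of P in [−u, u]. -/
theorem quintic_zero_root_bijection (m n p q : ℝ) (hm : m < 0)
    (P : ℝ → ℝ) (hP : ∀ t, P t = t^5 + m*t^3 + n*t^2 + p*t + q)
    (u : ℝ) (hu : u = 2 * Real.sqrt (-m) / Real.sqrt 5)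
    (α β γ : ℝ) (hα : α = 16*n/u^3) (hβ : β = 16*p/u^4 - 5) (hγ : γ = 16*q/u^5)
    (f : ℝ → ℝ)
    (hf : ∀ θ, f θ = α * Real.cos θ ^ 2 + β * Real.cos θ + Real.cos (5*θ) + γ) :
    (∀ θ₀ ∈ Set.Icc (0:ℝ) Real.pi, (f θ₀ = 0 ↔ P (u * Real.cos θ₀) = 0)) ∧
    Set.BijOn (fun θ => u * Real.cos θ)
      {θ ∈ Set.Icc (0:ℝ) Real.pi | f θ = 0}
      {t ∈ Set.Icc (-u) u | P t = 0} := by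
  have hu_pos : 0 < u := by
    rw [hu]
    have := Real.sqrt_pos.2 (neg_pos.2 hm)
    positivity
  have hm_eq : m = -(5 / 4) * u ^ 2 := by
    rw [hu, div_pow, mul_pow, Real.sq_sqrt (by linarith), Real.sq_sqrt (by norm_num)]
    ring
  have hP_cos : ∀ θ, P (u * Real.cos θ) = u ^ 5 / 16 * f θ := by
    intro θ
    rw [hP, hf, Real.cos_five_mul, hα, hβ, hγ, hm_eq]
    field_simp
    ring
  have hzero : ∀ θ, f θ = 0 ↔ P (u * Real.cos θ) = 0 := by
    intro θ
    rw [hP_cos, mul_eq_zero_iff_left (by positivity)]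
  refine ⟨fun θ _ => hzero θ, ?_, ?_, ?_⟩
  · rintro θ ⟨-, hθ⟩
    refine ⟨⟨?_, ?_⟩, (hzero θ).1 hθ⟩
    · nlinarith [Real.neg_one_le_cos θ]
    · nlinarith [Real.cos_le_one θ]
  · rintro x ⟨hx, -⟩ y ⟨hy, -⟩ hxy
    exact Real.injOn_cos hx hy (mul_left_cancel₀ hu_pos.ne' hxy)
  · rintro t ⟨⟨htl, htu⟩, ht⟩
    have hcos : u * Real.cos (Real.arccos (t / u)) = t := by
      rw [Real.cos_arccos ((le_div_iff₀ hu_pos).2 (by linarith))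
        ((div_le_one hu_pos).2 htu), mul_div_cancel₀ t hu_pos.ne']
    exact ⟨Real.arccos (t / u), ⟨⟨Real.arccos_nonneg _, Real.arccos_le_pi _⟩,
      (hzero _).2 (hcos.symm ▸ ht)⟩, hcos⟩
end

section
/- The function f has at most four critical points in the open interval (0, π); that is, the set {θ ∈ (0, π) : f′(θ) = 0} has at most four elements. (First part of Proposition 5; follows because the critical points correspond, via the injective map θ ↦ cos θ, to roots in (−1, 1) of the quartic 80x⁴ − 60x² + 2αx + (β + 5).) -/
open Polynomial in
/-- A real polynomial `Q` of degree at most `k` has at most `k` zeros of the form `cos θ`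
with `θ ∈ (0, π)`, counted by `θ`. -/
theorem encard_setOf_eval_cos_eq_zero_le {Q : ℝ[X]} (hQ : Q ≠ 0) {k : ℕ}
    (hk : Q.natDegree ≤ k) :
    {θ ∈ Set.Ioo (0 : ℝ) Real.pi | Q.eval (Real.cos θ) = 0}.encard ≤ k := by
  have hinj : Set.InjOn Real.cos {θ ∈ Set.Ioo (0 : ℝ) Real.pi | Q.eval (Real.cos θ) = 0} :=
    Real.injOn_cos.mono fun θ hθ => Set.Ioo_subset_Icc_self hθ.1
  rw [← hinj.encard_image]
  have hsub : Real.cos '' {θ ∈ Set.Ioo (0 : ℝ) Real.pi | Q.eval (Real.cos θ) = 0} ⊆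
      (Q.roots.toFinset : Set ℝ) := by
    rintro _ ⟨θ, hθ, rfl⟩
    simpa [hQ] using hθ.2
  refine (Set.encard_le_encard hsub).trans ?_
  rw [Set.encard_coe_eq_coe_finsetCard]
  exact_mod_cast (Multiset.toFinset_card_le _).trans ((card_roots' Q).trans hk)

theorem cos_five_mul_eq (θ : ℝ) :
    Real.cos (5 * θ) = 16 * Real.cos θ ^ 5 - 20 * Real.cos θ ^ 3 + 5 * Real.cos θ := by
  rw [show 5 * θ = 2 * θ + 3 * θ by ring, Real.cos_add, Real.cos_two_mul, Real.cos_three_mul,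
    Real.sin_two_mul, Real.sin_three_mul]
  linear_combination (8 * Real.cos θ * Real.sin θ ^ 2 + 2 * Real.cos θ
    - 8 * Real.cos θ ^ 3) * Real.sin_sq_add_cos_sq θ

theorem hasDerivAt_trigonometric_quintic (α β γ θ : ℝ) :
    HasDerivAt (fun θ => α * Real.cos θ ^ 2 + β * Real.cos θ + Real.cos (5 * θ) + γ)
      (-Real.sin θ * (80 * Real.cos θ ^ 4 - 60 * Real.cos θ ^ 2 + 2 * α * Real.cos θ
        + (β + 5))) θ := by
  simp only [cos_five_mul_eq]
  have h := Real.hasDerivAt_cos θ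
  refine ((((h.pow 2).const_mul α).add (h.const_mul β)).add
    ((((h.pow 5).const_mul 16).sub ((h.pow 3).const_mul 20)).add (h.const_mul 5))
    |>.add_const γ).congr_deriv ?_
  norm_num
  ring

/-- Proposition 5 (first part): f has at most four critical points in (0, π). -/
theorem quintic_at_most_four_critical_points (m n p q : ℝ) (hm : m < 0)
    (P : ℝ → ℝ) (hP : ∀ t, P t = t^5 + m*t^3 + n*t^2 + p*t + q)
    (u : ℝ) (hu : u = 2 * Real.sqrt (-m) / Real.sqrt 5)
    (α β γ : ℝ) (hα : α = 16*n/u^3) (hβ : β = 16*p/u^4 - 5) (hγ : γ = 16*q/u^5)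
    (f : ℝ → ℝ)
    (hf : ∀ θ, f θ = α * Real.cos θ ^ 2 + β * Real.cos θ + Real.cos (5*θ) + γ) :
    {θ ∈ Set.Ioo (0:ℝ) Real.pi | deriv f θ = 0}.encard ≤ 4 := by
  let Q : Polynomial ℝ := 80 * .X ^ 4 - 60 * .X ^ 2 + .C (2 * α) * .X + .C (β + 5)
  have hdeg : Q.natDegree = 4 := by
    unfold Q
    compute_degree!
  have hQ : Q ≠ 0 := Polynomial.ne_zero_of_natDegree_gt (n := 0) (by omega)
  refine (Set.encard_le_encard ?_).trans (encard_setOf_eval_cos_eq_zero_le hQ hdeg.le)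
  rintro θ ⟨hθ, hd⟩
  refine ⟨hθ, ?_⟩
  rw [funext hf, (hasDerivAt_trigonometric_quintic α β γ θ).deriv] at hd
  have hsin := (Real.sin_pos_of_mem_Ioo hθ).ne'
  simpa [Q, hsin] using hd
end
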